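/- Let {α_n}_{n≥1} be a sequence of real numbers with inf_{n≥1} α_n > 1. If lim_{n→∞} (log α_n)/n = 0, then lim_{n→∞} (∑_{i=1}^{n} log α_i)/(log ∑_{i=1}^{n} α_i) = +∞. -/

import Mathlib

open Filter

/-- If `inf_{n≥1} αₙ > 1` and `lim_{n→∞} (log αₙ)/n = 0`, then
`lim_{n→∞} (∑_{i=1}^n log αᵢ)/(log ∑_{i=1}^n αᵢ) = +∞`. -/
theorem tendsto_sum_log_div_log_sum_atTop (α : ℕ → ℝ)
    (hinf : ∃ l : ℝ, 1 < l ∧ ∀ n : ℕ, 1 ≤ n → l ≤ α n)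
    (h : Tendsto (fun n : ℕ => Real.log (α (n + 1)) / (n + 1 : ℝ)) atTop (nhds 0)) :
    Tendsto (fun n : ℕ =>
        (∑ i ∈ Finset.Icc 1 n, Real.log (α i)) / Real.log (∑ i ∈ Finset.Icc 1 n, α i))
      atTop atTop := by
  obtain ⟨l, hl, hα⟩ := hinf
  have hc : 0 < Real.log l := Real.log_pos hl
  rw [tendsto_atTop]
  intro b
  set B := max b 1 with hB
  have hB1 : 1 ≤ B := le_max_right _ _
  have hbB : b ≤ B := le_max_left _ _
  obtain ⟨ε, hε⟩ : ∃ ε, ε = Real.log l / (3 * B) := ⟨_, rfl⟩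
  have hε0 : 0 < ε := by rw [hε]; positivity
  have hεB : B * (3 * ε) = Real.log l := by rw [hε]; field_simp
  obtain ⟨N, hN⟩ := eventually_atTop.1 (h.eventually (gt_mem_nhds hε0))
  obtain ⟨C, hC⟩ : ∃ C, C = ∑ i ∈ Finset.range (N + 1), |Real.log (α i)| := ⟨_, rfl⟩
  have hC0 : 0 ≤ C := by rw [hC]; exact Finset.sum_nonneg fun _ _ => abs_nonneg _
  have hbound : ∀ i : ℕ, Real.log (α i) ≤ ε * i + C := by
    intro i
    by_cases hi : i < N + 1
    · have h1 : |Real.log (α i)| ≤ C := by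
        rw [hC]
        exact Finset.single_le_sum (f := fun i => |Real.log (α i)|)
          (fun _ _ => abs_nonneg _) (Finset.mem_range.2 hi)
      have h2 := le_abs_self (Real.log (α i))
      have h3 : 0 ≤ ε * (i : ℝ) := by positivity
      linarith
    · obtain ⟨j, rfl⟩ : ∃ j, i = j + 1 := ⟨i - 1, by omega⟩
      have h1 := hN j (by omega)
      have hj : (0 : ℝ) < (j : ℝ) + 1 := by positivity
      rw [div_lt_iff₀ hj] at h1
      push_cast
      linarith
  have hlog : ∀ᶠ n : ℕ in atTop, Real.log (n : ℝ) ≤ ε * n := by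
    have h1 := (Real.isLittleO_log_id_atTop.comp_tendsto
      (tendsto_natCast_atTop_atTop (R := ℝ))).bound hε0
    filter_upwards [h1] with n hn
    simp only [Function.comp, id, Real.norm_eq_abs, Nat.abs_cast] at hn
    exact (le_abs_self _).trans hn
  have hCn : ∀ᶠ n : ℕ in atTop, C / ε ≤ (n : ℝ) :=
    (tendsto_natCast_atTop_atTop (R := ℝ)).eventually_ge_atTop _
  filter_upwards [hlog, hCn, eventually_ge_atTop 1] with n h1 h2 hn
  rw [div_le_iff₀ hε0] at h2
  have hn1 : (1 : ℝ) ≤ n := by exact_mod_cast hn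
  have hS : (n : ℝ) * l ≤ ∑ i ∈ Finset.Icc 1 n, α i := by
    have := Finset.card_nsmul_le_sum (Finset.Icc 1 n) α l
      (fun i hi => hα i (Finset.mem_Icc.1 hi).1)
    simpa using this
  have hL : (n : ℝ) * Real.log l ≤ ∑ i ∈ Finset.Icc 1 n, Real.log (α i) := by
    have := Finset.card_nsmul_le_sum (Finset.Icc 1 n) (fun i => Real.log (α i)) (Real.log l)
      (fun i hi => Real.log_le_log (by linarith) (hα i (Finset.mem_Icc.1 hi).1))
    simpa using this
  have hS' : ∑ i ∈ Finset.Icc 1 n, α i ≤ n * Real.exp (ε * n + C) := by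
    have := Finset.sum_le_card_nsmul (Finset.Icc 1 n) α (Real.exp (ε * n + C))
      (fun i hi => by
        have hi' := Finset.mem_Icc.1 hi
        have hp : 0 < α i := by linarith [hα i hi'.1]
        rw [← Real.log_le_iff_le_exp hp]
        have hin : (i : ℝ) ≤ n := by exact_mod_cast hi'.2
        have := mul_le_mul_of_nonneg_left hin hε0.le
        linarith [hbound i])
    simpa using this
  have hS1 : 1 < ∑ i ∈ Finset.Icc 1 n, α i := by nlinarith
  have hlogS : Real.log (∑ i ∈ Finset.Icc 1 n, α i) ≤ 3 * ε * n := by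
    have h3 := Real.log_le_log (by linarith) hS'
    rw [Real.log_mul (by positivity) (Real.exp_ne_zero _), Real.log_exp] at h3
    linarith
  refine hbB.trans ?_
  rw [le_div_iff₀ (Real.log_pos hS1)]
  calc B * Real.log (∑ i ∈ Finset.Icc 1 n, α i) ≤ B * (3 * ε * n) :=
        mul_le_mul_of_nonneg_left hlogS (by linarith)
    _ = n * Real.log l := by rw [← hεB]; ring
    _ ≤ _ := hL
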